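/- Let T be an aperiodic, irreducible interval exchange transformation with no connections. Then for every nonempty open interval I ⊆ X the orbit of I covers X, i.e. ⋃_{k∈ℤ} T^k(I) = X; moreover there exist integers K ≤ L such that already ⋃_{k=K}^{L} T^k(I) = X. -/

import Mathlib

open Set Topology MeasureTheory

/-- A set `S` is *admissible* for `T` if it is closed and discrete and `T`
restricted to the complement of `S` is a homeomorphism onto the complement of a
closed discrete set. -/
def Admissible {X : Type*} [TopologicalSpace X] (T : X → X) (S : Set X) : Prop :=
  IsClosed S ∧ DiscreteTopology ↥S ∧
    ∃ S' : Set X, IsClosed S' ∧ DiscreteTopology ↥S' ∧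
      ∃ h : ↥(Sᶜ) ≃ₜ ↥(S'ᶜ), ∀ x : ↥(Sᶜ), (h x : X) = T (x : X)

/-- The set of singularities of `T`: the minimal admissible set. -/
def Sing {X : Type*} [TopologicalSpace X] (T : X → X) : Set X :=
  ⋂₀ {S | Admissible T S}

/-- The image of a set, never applying `T` at singular points. -/
def img {X : Type*} [TopologicalSpace X] (T : X → X) (A : Set X) : Set X :=
  T '' (A \ Sing T)

/-- The preimage of a set under `T`, i.e. the image under `T⁻¹`. -/
def preimg {X : Type*} [TopologicalSpace X] (T : X → X) (A : Set X) : Set X :=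
  {y | y ∉ Sing T ∧ T y ∈ A}

/-- The iterated image `T^k(A)`, `k ∈ ℤ`. -/
def iterImg {X : Type*} [TopologicalSpace X] (T : X → X) (k : ℤ) (A : Set X) : Set X :=
  if 0 ≤ k then (img T)^[k.toNat] A else (preimg T)^[(-k).toNat] A

/-- The forward orbit of a point. -/
def forwardOrbit {X : Type*} [TopologicalSpace X] (T : X → X) (x : X) : Set X :=
  ⋃ n : ℕ, (img T)^[n] ({x} : Set X)

/-- The (two-sided) orbit of a point. -/
def orbit {X : Type*} [TopologicalSpace X] (T : X → X) (x : X) : Set X :=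
  ⋃ k : ℤ, iterImg T k ({x} : Set X)

/-- `x` is periodic: `T^n(x) = x` for some `n ≥ 1`, all iterates being defined. -/
def IsPeriodicOrbit {X : Type*} [TopologicalSpace X] (T : X → X) (x : X) : Prop :=
  ∃ n : ℕ, 1 ≤ n ∧ x ∈ (img T)^[n] ({x} : Set X)

/-- An eligible map: it admits an admissible set and preserves the measure `μ`
away from singularities. -/
def Eligible {X : Type*} [TopologicalSpace X] [MeasurableSpace X] (μ : Measure X)
    (T : X → X) : Prop :=
  (∃ S, Admissible T S) ∧
    ∀ A : Set X, MeasurableSet A → A ⊆ (Sing T)ᶜ → μ (T '' A) = μ A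

/-- A finite union of bounded open intervals with pairwise disjoint closures. -/
def IsFiniteUnionOfIntervals (S : Set ℝ) : Prop :=
  ∃ (n : ℕ) (a b : Fin n → ℝ), (∀ i, a i < b i) ∧
    S = ⋃ i, Ioo (a i) (b i) ∧
    Pairwise fun i j => Disjoint (Icc (a i) (b i)) (Icc (a j) (b j))

/-- `T` is a translation on each connected component of `X \ Sing T`. -/
def IsTranslationOnComponents (X : Set ℝ) (T : ↥X → ↥X) : Prop :=
  ∀ x y : ↥X, x ∉ Sing T → y ∈ connectedComponentIn ((Sing T)ᶜ) x →
    (T y : ℝ) - (y : ℝ) = (T x : ℝ) - (x : ℝ)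

/-- An interval exchange transformation. -/
def IsIET (X : Set ℝ) (T : ↥X → ↥X) : Prop :=
  IsFiniteUnionOfIntervals X ∧
    Eligible (MeasureTheory.Measure.comap (Subtype.val : ↥X → ℝ) volume) T ∧
    (Sing T).Finite ∧ IsTranslationOnComponents X T

/-- A nontrivial union of connected components of `X` is invariant. -/
def IETReducible (X : Set ℝ) (T : ↥X → ↥X) : Prop :=
  ∃ U : Set ↥X, U.Nonempty ∧ U ≠ univ ∧
    (∀ x ∈ U, connectedComponent x ⊆ U) ∧ img T U ⊆ U


open Filter

theorem iterate_mem_of_infinite_iUnion {X : Type*} {g : X → X} {D : Set X} {x : X}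
    (h : (⋃ n : ℕ, (fun A => g '' (A ∩ D))^[n] {x}).Infinite) (n : ℕ) : g^[n] x ∈ D := by
  by_contra hn
  have hsub : ∀ m, (fun A => g '' (A ∩ D))^[m] {x} ⊆ {g^[m] x} := by
    intro m
    induction m with
    | zero => simp
    | succ m ih =>
      rw [Function.iterate_succ_apply', Function.iterate_succ_apply']
      rintro _ ⟨y, ⟨hy, -⟩, rfl⟩
      rw [mem_singleton_iff.1 (ih hy)]
      rfl
  have hempty : ∀ m, (fun A => g '' (A ∩ D))^[n + 1 + m] {x} = ∅ := by
    intro m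
    induction m with
    | zero =>
      rw [add_zero, Function.iterate_succ_apply', image_eq_empty, eq_empty_iff_forall_notMem]
      rintro y ⟨hy, hyD⟩
      exact hn (mem_singleton_iff.1 (hsub n hy) ▸ hyD)
    | succ m ih => rw [← add_assoc, Function.iterate_succ_apply', ih]; simp
  refine h (((finite_le_nat n).image fun m => g^[m] x).subset (iUnion_subset fun m y hy => ?_))
  rcases le_or_gt m n with hm | hm
  · exact ⟨m, hm, (mem_singleton_iff.1 (hsub m hy)).symm⟩
  · obtain ⟨j, rfl⟩ := Nat.exists_eq_add_of_le (Nat.succ_le_of_lt hm)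
    rw [Nat.succ_eq_add_one, hempty] at hy
    exact hy.elim

section Topological

variable {X : Type*} [TopologicalSpace X] {T : X → X} {S : Set X}

theorem eventually_notMem_of_isClosed_of_discreteTopology (hc : IsClosed S)
    (hd : DiscreteTopology ↥S) (x : X) : ∀ᶠ z in 𝓝[≠] x, z ∉ S := by
  have h := isClosed_and_discrete_iff.1 ⟨hc, isDiscrete_iff_discreteTopology.2 hd⟩ x
  exact disjoint_principal_right.1 h

namespace Admissible

theorem sing_subset (h : Admissible T S) : Sing T ⊆ S := sInter_subset_of_mem h

theorem map_nhds (h : Admissible T S) {x : X} (hx : x ∉ S) : map T (𝓝 x) = 𝓝 (T x) := by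
  obtain ⟨hc, -, S', hc', -, e, he⟩ := h
  have h1 : map ((↑) : ↥(Sᶜ) → X) (𝓝 ⟨x, hx⟩) = 𝓝 x :=
    map_nhds_subtype_coe_eq_nhds (p := (· ∈ Sᶜ)) hx (hc.isOpen_compl.mem_nhds hx)
  have h2 : map ((↑) : ↥(S'ᶜ) → X) (𝓝 (e ⟨x, hx⟩)) = 𝓝 (e ⟨x, hx⟩ : X) :=
    map_nhds_subtype_coe_eq_nhds (p := (· ∈ S'ᶜ)) (e ⟨x, hx⟩).2
      (hc'.isOpen_compl.mem_nhds (e ⟨x, hx⟩).2)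
  rw [← h1, Filter.map_map, ← he ⟨x, hx⟩, ← h2, ← e.map_nhds_eq, Filter.map_map]
  congr 1
  funext y
  exact (he y).symm

theorem injOn (h : Admissible T S) : InjOn T Sᶜ := by
  obtain ⟨-, -, S', -, -, e, he⟩ := h
  intro x hx y hy hxy
  have : e ⟨x, hx⟩ = e ⟨y, hy⟩ := Subtype.ext (by rw [he, he]; exact hxy)
  exact congrArg Subtype.val (e.injective this)

theorem eventually_mem_image (h : Admissible T S) (x : X) : ∀ᶠ z in 𝓝[≠] x, z ∈ T '' Sᶜ := by
  obtain ⟨-, -, S', hc', hd', e, he⟩ := h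
  filter_upwards [eventually_notMem_of_isClosed_of_discreteTopology hc' hd' x] with z hz
  refine ⟨e.symm ⟨z, hz⟩, (e.symm ⟨z, hz⟩).2, ?_⟩
  rw [← he, e.apply_symm_apply]

end Admissible

theorem exists_admissible_of_notMem_sing {x : X} (hx : x ∉ Sing T) :
    ∃ S, Admissible T S ∧ x ∉ S := by
  simpa [Sing] using hx

theorem map_nhds_of_notMem_sing {x : X} (hx : x ∉ Sing T) : map T (𝓝 x) = 𝓝 (T x) := by
  obtain ⟨S, hS, hxS⟩ := exists_admissible_of_notMem_sing hx
  exact hS.map_nhds hxS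

theorem isClosed_sing : IsClosed (Sing T) := isClosed_sInter fun _ hS => hS.1

theorem injOn_compl_sing [T2Space X] (hX : ∀ x : X, (𝓝[≠] x).NeBot) : InjOn T (Sing T)ᶜ := by
  intro x hx y hy hxy
  by_contra hne
  obtain ⟨S₁, h₁, hx₁⟩ := exists_admissible_of_notMem_sing hx
  obtain ⟨S₂, h₂, hy₂⟩ := exists_admissible_of_notMem_sing hy
  obtain ⟨U, V, hU, hV, hxU, hyV, hUV⟩ := t2_separation hne
  have key : ∀ {z : X} {W : Set X}, z ∉ Sing T → IsOpen W → z ∈ W →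
      ∀ᶠ q in 𝓝[≠] (T z), ∃ u ∈ W, u ∉ S₁ ∧ u ∉ S₂ ∧ T u = q := by
    intro z W hz hW hzW
    have hev : ∀ᶠ u in 𝓝 z, u ≠ z → u ∈ W ∧ u ∉ S₁ ∧ u ∉ S₂ := by
      refine eventually_nhdsWithin_iff (s := {z}ᶜ).1 ?_
      filter_upwards [mem_nhdsWithin_of_mem_nhds (hW.mem_nhds hzW),
        eventually_notMem_of_isClosed_of_discreteTopology h₁.1 h₁.2.1 z,
        eventually_notMem_of_isClosed_of_discreteTopology h₂.1 h₂.2.1 z] with u h h' h''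
      exact ⟨h, h', h''⟩
    have := image_mem_map (m := T) hev
    rw [map_nhds_of_notMem_sing hz] at this
    filter_upwards [mem_nhdsWithin_of_mem_nhds this, self_mem_nhdsWithin] with q hq hqz
    obtain ⟨u, hu, rfl⟩ := hq
    have hu' := hu (fun h => hqz (by simp [h]))
    exact ⟨u, hu'.1, hu'.2.1, hu'.2.2, rfl⟩
  have := hX (T x)
  have kx := key hx hU hxU
  have ky := key hy hV hyV
  rw [← hxy] at ky
  obtain ⟨q, ⟨u, huU, hu₁, -, rfl⟩, ⟨v, hvV, hv₁, -, hvu⟩⟩ := (kx.and ky).exists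
  have := h₁.injOn hv₁ hu₁ hvu
  subst this
  exact disjoint_left.1 hUV huU hvV

theorem exists_openPartialHomeomorph_of_admissible [T2Space X] [Nonempty X]
    (hX : ∀ x : X, (𝓝[≠] x).NeBot) (hS : Admissible T S) :
    ∃ e : OpenPartialHomeomorph X X, (e : X → X) = T ∧ e.source = (Sing T)ᶜ ∧
      ∀ x, ∀ᶠ z in 𝓝[≠] x, z ∈ e.target := by
  have hopen : IsOpenMap ((Sing T)ᶜ.domRestrict T) := by
    rw [isOpenMap_iff_nhds_le]
    rintro ⟨x, hx⟩
    have h1 : map ((↑) : ↥((Sing T)ᶜ) → X) (𝓝 ⟨x, hx⟩) = 𝓝 x :=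
      map_nhds_subtype_coe_eq_nhds (p := (· ∈ (Sing T)ᶜ)) hx
        (isClosed_sing.isOpen_compl.mem_nhds hx)
    have h2 := map_nhds_of_notMem_sing hx
    rw [← h1, Filter.map_map] at h2
    exact h2.ge
  have hcont : ContinuousOn T (Sing T)ᶜ := fun x hx =>
    (show Tendsto T (𝓝 x) (𝓝 (T x)) from (map_nhds_of_notMem_sing hx).le).mono_left
      nhdsWithin_le_nhds
  refine ⟨OpenPartialHomeomorph.ofContinuousOpenRestrict
    ((injOn_compl_sing hX).toPartialEquiv T _) hcont hopen isClosed_sing.isOpen_compl,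
    rfl, rfl, fun x => ?_⟩
  filter_upwards [hS.eventually_mem_image x] with z hz
  exact image_mono (compl_subset_compl.2 hS.sing_subset) hz

/-! ### Iterated images -/

theorem mem_iterImg_succ_iff (hT : InjOn T (Sing T)ᶜ) {x : X} (hx : x ∉ Sing T) (A : Set X)
    (k : ℤ) : T x ∈ iterImg T (k + 1) A ↔ x ∈ iterImg T k A := by
  rcases le_or_gt 0 k with hk | hk
  · lift k to ℕ using hk
    have h1 : ((k : ℤ) + 1).toNat = k + 1 := by omega
    simp only [iterImg, h1, Int.toNat_natCast, Int.natCast_nonneg, if_true,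
      show (0 : ℤ) ≤ (k : ℤ) + 1 by omega, Function.iterate_succ_apply']
    constructor
    · rintro ⟨y, ⟨hy, hyS⟩, hyx⟩
      exact hT hyS hx hyx ▸ hy
    · exact fun h => ⟨x, ⟨h, hx⟩, rfl⟩
  · obtain ⟨n, rfl⟩ : ∃ n : ℕ, k = -((n : ℤ) + 1) := ⟨(-k - 1).toNat, by omega⟩
    have h1 : iterImg T (-((n : ℤ) + 1) + 1) A = (preimg T)^[n] A := by
      rcases n with _ | n
      · simp [iterImg]
      · have h2 : (-(-(((n + 1 : ℕ) : ℤ) + 1) + 1)).toNat = n + 1 := by omega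
        rw [iterImg, if_neg (by omega), h2]
    have h3 : (- -((n : ℤ) + 1)).toNat = n + 1 := by omega
    rw [h1, iterImg, if_neg (by omega), h3, Function.iterate_succ_apply']
    exact ⟨fun h => ⟨hx, h⟩, fun h => h.2⟩

theorem mem_iterate_img {w : ℕ → X} (hw : ∀ n, w n ∉ Sing T) (hTw : ∀ n, T (w n) = w (n + 1))
    (n k : ℕ) : w (n + k) ∈ (img T)^[k] {w n} := by
  induction k with
  | zero => simp
  | succ k ih =>
    rw [Function.iterate_succ_apply']
    exact ⟨_, ⟨ih, hw _⟩, hTw _⟩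

theorem orbit_subset (T : X → X) (x : X) :
    orbit T x ⊆ (⋃ n : ℕ, (img T)^[n] {x}) ∪ ⋃ n : ℕ, (preimg T)^[n] {x} := by
  refine iUnion_subset fun k y hy => ?_
  unfold iterImg at hy
  split_ifs at hy
  · exact Or.inl (mem_iUnion.2 ⟨_, hy⟩)
  · exact Or.inr (mem_iUnion.2 ⟨_, hy⟩)

theorem img_eq_image {e : OpenPartialHomeomorph X X} (hT : (e : X → X) = T)
    (hs : e.source = (Sing T)ᶜ) (A : Set X) : img T A = e '' (A ∩ e.source) := by
  rw [img, hT, hs, sdiff_eq]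

theorem preimg_eq_image_symm {e : OpenPartialHomeomorph X X} (hT : (e : X → X) = T)
    (hs : e.source = (Sing T)ᶜ) (A : Set X) : preimg T A = e.symm '' (A ∩ e.target) := by
  ext y
  constructor
  · rintro ⟨hy, hyA⟩
    have hys : y ∈ e.source := by rw [hs]; exact hy
    exact ⟨T y, ⟨hyA, hT ▸ e.map_source hys⟩, by rw [← hT, e.left_inv hys]⟩
  · rintro ⟨z, ⟨hzA, hzt⟩, rfl⟩
    have h := e.map_target hzt
    rw [hs] at h
    exact ⟨h, by rw [← hT, e.right_inv hzt]; exact hzA⟩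

theorem isOpen_iterImg {e : OpenPartialHomeomorph X X} (hT : (e : X → X) = T)
    (hs : e.source = (Sing T)ᶜ) {A : Set X} (hA : IsOpen A) (k : ℤ) : IsOpen (iterImg T k A) := by
  have h1 : ∀ n : ℕ, IsOpen ((img T)^[n] A) := by
    intro n
    induction n with
    | zero => exact hA
    | succ n ih =>
      rw [Function.iterate_succ_apply', img_eq_image hT hs, inter_comm]
      exact e.isOpen_image_source_inter ih
  have h2 : ∀ n : ℕ, IsOpen ((preimg T)^[n] A) := by
    intro n
    induction n with
    | zero => exact hA
    | succ n ih =>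
      rw [Function.iterate_succ_apply', preimg_eq_image_symm hT hs, inter_comm]
      exact e.symm.isOpen_image_source_inter ih
  unfold iterImg
  split_ifs
  exacts [h1 _, h2 _]

/-- If no orbit is periodic and the orbit of `x` is infinite, then `x` can be iterated
indefinitely, without repetition, either forwards or backwards. -/
theorem iterate_mem_source_or_symm {e : OpenPartialHomeomorph X X} (hT : (e : X → X) = T)
    (hs : e.source = (Sing T)ᶜ) (hper : ∀ x, ¬ IsPeriodicOrbit T x) {x : X}
    (hx : (orbit T x).Infinite) :
    ((∀ n, e^[n] x ∈ e.source) ∧ Function.Injective fun n : ℕ => e^[n] x) ∨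
      (∀ n, e.symm^[n] x ∈ e.target) ∧ Function.Injective fun n : ℕ => e.symm^[n] x := by
  rcases infinite_union.1 (hx.mono (orbit_subset T x)) with h | h
  · left
    rw [show img T = _ from funext (img_eq_image hT hs)] at h
    have hD := iterate_mem_of_infinite_iUnion h
    have hS : ∀ n, e^[n] x ∉ Sing T := fun n => by simpa [hs] using hD n
    refine ⟨hD, Function.Injective.of_lt_imp_ne fun n m hnm heq =>
      hper (e^[n] x) ⟨m - n, by omega, ?_⟩⟩
    have := mem_iterate_img hS (fun n => by rw [Function.iterate_succ_apply', hT]) n (m - n)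
    rwa [Nat.add_sub_cancel' hnm.le, ← (show e^[n] x = e^[m] x from heq)] at this
  · right
    rw [show preimg T = _ from funext (preimg_eq_image_symm hT hs)] at h
    have hD := iterate_mem_of_infinite_iUnion h
    have hS : ∀ n, e.symm^[n + 1] x ∈ e.source := fun n => by
      rw [Function.iterate_succ_apply']; exact e.map_target (hD n)
    have hback : ∀ k n, e.symm^[n] x ∈ (img T)^[k] {e.symm^[n + k] x} := by
      intro k
      induction k with
      | zero => simp
      | succ k ih =>
        intro n
        rw [Function.iterate_succ_apply']
        refine ⟨e.symm^[n + 1] x, ⟨?_, by simpa [hs] using hS n⟩, ?_⟩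
        · have := ih (n + 1)
          rwa [add_right_comm] at this
        · rw [Function.iterate_succ_apply', ← hT, e.right_inv (hD n)]
    refine ⟨hD, Function.Injective.of_lt_imp_ne fun n m hnm heq =>
      hper (e.symm^[m] x) ⟨m - n, by omega, ?_⟩⟩
    have := hback (m - n) n
    rwa [Nat.add_sub_cancel' hnm.le, (show e.symm^[n] x = e.symm^[m] x from heq)] at this

end Topological

section Rays

theorem eventually_nhdsGT_zero_iff {P : ℝ → Prop} :
    (∀ᶠ t in 𝓝[>] (0 : ℝ), P t) ↔ ∃ ε > 0, ∀ t ∈ Ioo 0 ε, P t :=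
  mem_nhdsGT_iff_exists_Ioo_subset

theorem eventually_add_mul_notMem {B : Set ℝ} (hB : B.Finite) (p : ℝ) {s : ℝ} (hs : s ≠ 0) :
    ∀ᶠ t in 𝓝[>] (0 : ℝ), p + s * t ∉ B := by
  have hinj : Function.Injective fun t : ℝ => p + s * t := fun t t' h =>
    mul_left_cancel₀ hs (add_left_cancel h)
  have hf : ((fun t : ℝ => p + s * t) ⁻¹' B \ {0}).Finite := (hB.preimage hinj.injOn).sdiff
  have h0 := hf.isClosed.isOpen_compl.mem_nhds (x := (0 : ℝ)) (by simp)
  filter_upwards [mem_nhdsWithin_of_mem_nhds h0, self_mem_nhdsWithin] with t ht ht0 htB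
  exact ht ⟨htB, (mem_Ioi.1 ht0).ne'⟩

theorem exists_dist_lt_of_isBounded_range {x : ℕ → ℝ} (hx : Bornology.IsBounded (range x)) (N : ℕ)
    {ε : ℝ} (hε : 0 < ε) : ∃ n m, N ≤ n ∧ n < m ∧ dist (x n) (x m) < ε := by
  obtain ⟨a, -, φ, hφ, hlim⟩ := tendsto_subseq_of_bounded hx fun n => mem_range_self n
  obtain ⟨M, hM⟩ := Metric.cauchySeq_iff.1 hlim.cauchySeq ε hε
  refine ⟨φ (max M N), φ (max M N + 1), (le_max_right M N).trans (hφ.id_le _),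
    hφ (Nat.lt_succ_self _), hM _ (le_max_left _ _) _ ((le_max_left M N).trans (Nat.le_succ _))⟩

/-- A gap of `V` cannot be transported along an injective bounded sequence of points outside `V`
if transport only fails at finitely many obstructions: from some point on the lengths of the gaps
would not decrease. -/
theorem false_of_transported_gap {V B : Set ℝ} (hB : B.Finite) {x : ℕ → ℝ}
    (hx : Function.Injective x) (hxV : ∀ n, x n ∉ V) (hbdd : Bornology.IsBounded (range x))
    {s : ℝ} (hs : s ≠ 0) (h0 : ∀ᶠ t in 𝓝[>] (0 : ℝ), x 0 + s * t ∈ V)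
    (hstep : ∀ n, ∀ ℓ > 0, (∀ t ∈ Ioo 0 ℓ, x n + s * t ∈ V \ B) →
      ∀ t ∈ Ioo 0 ℓ, x (n + 1) + s * t ∈ V) : False := by
  have hgerm : ∀ n, ∀ᶠ t in 𝓝[>] (0 : ℝ), x n + s * t ∈ V := by
    intro n
    induction n with
    | zero => exact h0
    | succ n ih =>
      obtain ⟨ε, hε, h⟩ := eventually_nhdsGT_zero_iff.1
        (ih.and (eventually_add_mul_notMem hB (x n) hs))
      exact eventually_nhdsGT_zero_iff.2 ⟨ε, hε, hstep n ε hε h⟩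
  have hdisj : ∀ n m t t', 0 < t → t < t' → (∀ r ∈ Ioo 0 t', x m + s * r ∈ V) →
      x n + s * t ≠ x m + s * t' := by
    intro n m t t' ht htt' h heq
    refine hxV n ?_
    have := h (t' - t) ⟨by linarith, by linarith⟩
    rwa [show x m + s * (t' - t) = x n by linarith] at this
  obtain ⟨N, hN⟩ : ∃ N, ∀ n ≥ N, ∀ ℓ > 0, (∀ t ∈ Ioo 0 ℓ, x n + s * t ∈ V) →
      x n + s * ℓ ∉ B := by
    have hfin : {n | ∃ ℓ > 0, (∀ t ∈ Ioo 0 ℓ, x n + s * t ∈ V) ∧ x n + s * ℓ ∈ B}.Finite := by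
      have : ∀ n, ∃ ℓ, n ∈ {n | ∃ ℓ > 0, (∀ t ∈ Ioo 0 ℓ, x n + s * t ∈ V) ∧ x n + s * ℓ ∈ B} →
          0 < ℓ ∧ (∀ t ∈ Ioo 0 ℓ, x n + s * t ∈ V) ∧ x n + s * ℓ ∈ B := by
        intro n
        by_cases h : n ∈ {n | ∃ ℓ > 0, (∀ t ∈ Ioo 0 ℓ, x n + s * t ∈ V) ∧ x n + s * ℓ ∈ B}
        · obtain ⟨ℓ, hℓ, h'⟩ := h
          exact ⟨ℓ, fun _ => ⟨hℓ, h'⟩⟩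
        · exact ⟨0, fun h' => absurd h' h⟩
      choose ℓ hℓ using this
      refine Set.Finite.of_injOn (f := fun n => x n + s * ℓ n) (fun n hn => (hℓ n hn).2.2) ?_ hB
      intro n hn m hm heq
      rcases lt_trichotomy (ℓ n) (ℓ m) with h | h | h
      · exact absurd heq (hdisj n m _ _ (hℓ n hn).1 h (hℓ m hm).2.1)
      · refine hx ?_
        simp only [h] at heq
        exact add_right_cancel heq
      · exact absurd heq.symm (hdisj m n _ _ (hℓ m hm).1 h (hℓ n hn).2.1)
    obtain ⟨N, hN⟩ := hfin.bddAbove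
    exact ⟨N + 1, fun n hn ℓ hℓ h hB => absurd (hN ⟨ℓ, hℓ, h, hB⟩) (by omega)⟩
  obtain ⟨ε, hε, hεV⟩ := eventually_nhdsGT_zero_iff.1 (hgerm N)
  have hall : ∀ n ≥ N, ∀ t ∈ Ioo 0 ε, x n + s * t ∈ V := by
    intro n hn
    induction n, hn using Nat.le_induction with
    | base => exact hεV
    | succ n hn ih =>
      exact hstep n ε hε fun t ht =>
        ⟨ih t ht, hN n hn t ht.1 fun r hr => ih r ⟨hr.1, hr.2.trans ht.2⟩⟩
  obtain ⟨n, m, hn, hnm, hd⟩ := exists_dist_lt_of_isBounded_range hbdd N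
    (mul_pos (abs_pos.2 hs) hε)
  have hne : x n - x m ≠ 0 := sub_ne_zero.2 fun h => hnm.ne (hx h)
  have hτ : |(x n - x m) / s| < ε := by
    rw [abs_div, div_lt_iff₀ (abs_pos.2 hs), mul_comm]
    exact hd
  have hsτ : s * ((x n - x m) / s) = x n - x m := mul_div_cancel₀ _ hs
  have hτ0 : (x n - x m) / s ≠ 0 := div_ne_zero hne hs
  rcases lt_or_gt_of_ne hτ0 with h | h
  · rw [abs_of_neg h] at hτ
    have := hall n hn _ ⟨neg_pos.2 h, hτ⟩
    rw [mul_neg, hsτ, show x n + -(x n - x m) = x m by ring] at this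
    exact hxV m this
  · rw [abs_of_pos h] at hτ
    have := hall m (hn.trans hnm.le) _ ⟨h, hτ⟩
    rw [hsτ, show x m + (x n - x m) = x n by ring] at this
    exact hxV n this

theorem isPreconnected_image_add_mul (p s : ℝ) {A : Set ℝ} (hA : IsPreconnected A) :
    IsPreconnected ((fun t => p + s * t) '' A) :=
  hA.image _ (by fun_prop)

end Rays

section LocalTranslations

variable {X : Set ℝ}

/-- A partial homeomorphism of `X ⊆ ℝ` which is a translation on every connected subset of its
source. -/
def IsLocalTranslation (e : OpenPartialHomeomorph ↥X ↥X) : Prop :=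
  ∀ J : Set ↥X, IsPreconnected J → J ⊆ e.source → ∀ x ∈ J, ∀ y ∈ J,
    (e y : ℝ) - (y : ℝ) = (e x : ℝ) - (x : ℝ)

namespace IsLocalTranslation

variable {e : OpenPartialHomeomorph ↥X ↥X}

theorem symm (he : IsLocalTranslation e) : IsLocalTranslation e.symm := by
  intro J hJ hJe x hx y hy
  have hmaps : e.symm '' J ⊆ e.source := by
    rintro _ ⟨z, hz, rfl⟩
    exact e.map_target (hJe hz)
  have := he _ (hJ.image _ (e.continuousOn_symm.mono hJe)) hmaps _ (mem_image_of_mem _ hx) _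
    (mem_image_of_mem _ hy)
  rw [e.right_inv (hJe hx), e.right_inv (hJe hy)] at this
  linarith

theorem exists_translation (he : IsLocalTranslation e) {A : Set ℝ} (hA : IsPreconnected A)
    (hAe : A ⊆ (↑) '' e.source) :
    ∃ δ : ℝ, ∀ x : ↥X, (x : ℝ) ∈ A → x ∈ e.source ∧ (e x : ℝ) = x + δ := by
  have hsrc : ((↑) : ↥X → ℝ) ⁻¹' A ⊆ e.source := by
    intro x hx
    obtain ⟨y, hy, hyx⟩ := hAe hx
    exact Subtype.ext hyx ▸ hy
  have hJ : IsPreconnected (((↑) : ↥X → ℝ) ⁻¹' A) := by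
    rw [← IsInducing.subtypeVal.isPreconnected_image, Subtype.image_preimage_coe,
      inter_eq_right.2 (hAe.trans (image_subset_range _ _) |>.trans Subtype.range_coe.subset)]
    exact hA
  rcases (((↑) : ↥X → ℝ) ⁻¹' A).eq_empty_or_nonempty with h | ⟨x, hx⟩
  · exact ⟨0, fun x hx => absurd (show x ∈ ((↑) : ↥X → ℝ) ⁻¹' A from hx) (h ▸ notMem_empty x)⟩
  · exact ⟨e x - x, fun y hy => ⟨hsrc hy, by linarith [he _ hJ hsrc x hx y hy]⟩⟩

/-- The image of a ray `p + s * t` under a local translation. -/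
theorem exists_ray (he : IsLocalTranslation e) {p s ε : ℝ}
    (h : ∀ t ∈ Ioo 0 ε, p + s * t ∈ ((↑) : ↥X → ℝ) '' e.source) :
    ∃ q : ℝ, ∀ t ∈ Ioo 0 ε, ∃ x ∈ e.source, (x : ℝ) = p + s * t ∧ (e x : ℝ) = q + s * t := by
  obtain ⟨δ, hδ⟩ := he.exists_translation (isPreconnected_image_add_mul p s isPreconnected_Ioo)
    (image_subset_iff.2 h)
  refine ⟨p + δ, fun t ht => ?_⟩
  obtain ⟨x, hx, hxp⟩ := h t ht
  exact ⟨x, hx, hxp, by rw [(hδ x ⟨t, ht, hxp.symm⟩).2, hxp]; ring⟩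

theorem exists_ray_of_mem (he : IsLocalTranslation e) {x : ↥X} {s ε : ℝ} (hx : x ∈ e.source)
    (h : ∀ t ∈ Ioo 0 ε, (x : ℝ) + s * t ∈ ((↑) : ↥X → ℝ) '' e.source) {t : ℝ} (ht : t ∈ Ioo 0 ε) :
    ∃ y ∈ e.source, (y : ℝ) = x + s * t ∧ (e y : ℝ) = e x + s * t := by
  have hε : 0 < ε := ht.1.trans ht.2
  obtain ⟨δ, hδ⟩ := he.exists_translation
    (isPreconnected_image_add_mul x s (isPreconnected_Ico (a := 0) (b := ε))) (by
      rintro _ ⟨r, hr, rfl⟩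
      rcases hr.1.eq_or_lt with rfl | hr0
      · exact ⟨x, hx, by simp⟩
      · exact h r ⟨hr0, hr.2⟩)
  obtain ⟨y, hy, hyx⟩ := h t ht
  refine ⟨y, hy, hyx, ?_⟩
  rw [(hδ y ⟨t, Ioo_subset_Ico_self ht, hyx.symm⟩).2, (hδ x ⟨0, ⟨le_rfl, hε⟩, by simp⟩).2, hyx]
  ring

theorem finite_compl_target (he : IsLocalTranslation e) (hX : IsOpen X)
    (hfr : (closure X \ X).Finite) (hsrc : e.sourceᶜ.Finite)
    (htgt : ∀ x, ∀ᶠ z in 𝓝[≠] x, z ∈ e.target) : e.targetᶜ.Finite := by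
  have key : ∀ y : ↥X, ∃ c : ℝ, ∃ ε > 0, ∀ t ∈ Ioo (0 : ℝ) ε,
      ∃ x ∈ e.source, (x : ℝ) = c + 1 * t ∧ (e x : ℝ) = y + 1 * t := by
    intro y
    have h1 : ∀ᶠ r : ℝ in 𝓝 (y : ℝ), r ≠ (y : ℝ) → r ∈ ((↑) : ↥X → ℝ) '' e.target := by
      rw [← map_nhds_subtype_coe_eq_nhds (p := (· ∈ X)) y.2 (hX.mem_nhds y.2), eventually_map]
      filter_upwards [eventually_nhdsWithin_iff.1 (htgt y)] with z hz hzy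
      exact ⟨z, hz fun h => hzy (congrArg Subtype.val (mem_singleton_iff.1 h)), rfl⟩
    have h2 : ∀ᶠ t in 𝓝[>] (0 : ℝ), (y : ℝ) + 1 * t ∈ ((↑) : ↥X → ℝ) '' e.target := by
      have hc : Tendsto (fun t : ℝ => (y : ℝ) + 1 * t) (𝓝[>] 0) (𝓝 y) := by
        refine Tendsto.mono_left (Continuous.tendsto' (by fun_prop) _ _ (by simp))
          nhdsWithin_le_nhds
      filter_upwards [hc.eventually h1, self_mem_nhdsWithin] with t ht ht0
      exact ht (by simpa using (mem_Ioi.1 ht0).ne')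
    obtain ⟨ε, hε, h⟩ := eventually_nhdsGT_zero_iff.1 h2
    obtain ⟨c, hc⟩ := he.symm.exists_ray h
    refine ⟨c, ε, hε, fun t ht => ?_⟩
    obtain ⟨x, hx, hxy, hxc⟩ := hc t ht
    exact ⟨e.symm x, e.map_target hx, hxc, by rw [e.right_inv hx, hxy]⟩
  choose c hc using key
  refine Set.Finite.of_injOn (f := c)
    (t := (closure X \ X) ∪ ((↑) : ↥X → ℝ) '' e.sourceᶜ) ?_ ?_ (hfr.union (hsrc.image _))
  · intro y hy
    obtain ⟨ε, hε, h⟩ := hc y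
    by_cases hcX : c y ∈ X
    · refine Or.inr ⟨⟨c y, hcX⟩, fun hcs => hy ?_, rfl⟩
      have h' : ∀ t ∈ Ioo 0 ε, ((⟨c y, hcX⟩ : ↥X) : ℝ) + 1 * t ∈ ((↑) : ↥X → ℝ) '' e.source :=
        fun t ht => by
          obtain ⟨x, hx, hxc, -⟩ := h t ht
          exact ⟨x, hx, hxc⟩
      have ht : ε / 2 ∈ Ioo 0 ε := ⟨by linarith, by linarith⟩
      obtain ⟨z, hz, hzc, hez⟩ := he.exists_ray_of_mem hcs h' ht
      obtain ⟨x, hx, hxc, hex⟩ := h _ ht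
      obtain rfl : z = x := Subtype.ext (hzc.trans hxc.symm)
      have : e ⟨c y, hcX⟩ = y := Subtype.ext (by linarith)
      exact this ▸ e.map_source hcs
    · refine Or.inl ⟨?_, hcX⟩
      have hlim : Tendsto (fun t : ℝ => c y + 1 * t) (𝓝[>] 0) (𝓝 (c y)) :=
        Tendsto.mono_left (Continuous.tendsto' (by fun_prop) _ _ (by simp)) nhdsWithin_le_nhds
      refine mem_closure_of_tendsto hlim (eventually_nhdsGT_zero_iff.2 ⟨ε, hε, fun t ht => ?_⟩)
      obtain ⟨x, -, hxc, -⟩ := h t ht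
      exact hxc ▸ x.2
  · intro y _ y' _ hyy'
    obtain ⟨ε, hε, h⟩ := hc y
    obtain ⟨ε', hε', h'⟩ := hc y'
    have hm : 0 < min ε ε' := lt_min hε hε'
    have hlt : min ε ε' / 2 < min ε ε' := by linarith
    obtain ⟨x, -, hxc, hex⟩ := h (min ε ε' / 2) ⟨by linarith, hlt.trans_le (min_le_left _ _)⟩
    obtain ⟨x', -, hxc', hex'⟩ := h' (min ε ε' / 2) ⟨by linarith, hlt.trans_le (min_le_right _ _)⟩
    obtain rfl : x = x' := Subtype.ext (by rw [hxc, hxc', hyy'])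
    exact Subtype.ext (by linarith)

/-- An invariant set of a local translation has no gap germ at a point of its complement that
can be iterated indefinitely. -/
theorem false_of_gap (he : IsLocalTranslation e) (hsrc : e.sourceᶜ.Finite)
    (hbdd : Bornology.IsBounded X) {U : Set ↥X} (hU : ∀ x ∈ e.source, e x ∈ U ↔ x ∈ U) {x : ↥X}
    (hx : x ∉ U) {s : ℝ} (hs : s ≠ 0)
    (hgap : ∀ᶠ t in 𝓝[>] (0 : ℝ), (x : ℝ) + s * t ∈ ((↑) : ↥X → ℝ) '' U)
    (hiter : ∀ n, e^[n] x ∈ e.source) (hinj : Function.Injective fun n : ℕ => e^[n] x) :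
    False := by
  refine false_of_transported_gap (V := ((↑) : ↥X → ℝ) '' U) (hsrc.image ((↑) : ↥X → ℝ))
    (x := fun n => (e^[n] x : ℝ)) (Subtype.val_injective.comp hinj) ?_ (hbdd.subset ?_) hs hgap ?_
  · rintro n ⟨y, hy, hyn⟩
    obtain rfl : y = e^[n] x := Subtype.ext hyn
    clear hyn
    induction n with
    | zero => exact hx hy
    | succ n ih =>
      rw [Function.iterate_succ_apply', hU _ (hiter n)] at hy
      exact ih hy
  · rintro _ ⟨n, rfl⟩
    exact (e^[n] x).2
  · intro n ℓ _ h t ht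
    have h' : ∀ t ∈ Ioo 0 ℓ, (e^[n] x : ℝ) + s * t ∈ ((↑) : ↥X → ℝ) '' e.source := by
      intro t ht
      obtain ⟨⟨y, -, hyt⟩, hB⟩ := h t ht
      exact ⟨y, by_contra fun hy => hB ⟨y, hy, hyt⟩, hyt⟩
    obtain ⟨y, hy, hyx, hey⟩ := he.exists_ray_of_mem (hiter n) h' ht
    obtain ⟨⟨z, hz, hzt⟩, -⟩ := h t ht
    obtain rfl : z = y := Subtype.ext (hzt.trans hyx.symm)
    refine ⟨e z, (hU z hy).2 hz, ?_⟩
    rw [hey, Function.iterate_succ_apply']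

end IsLocalTranslation

/-- An open subset of `X` which is not closed has a gap endpoint in its complement. -/
theorem exists_gap_endpoint (hX : IsOpen X) {U : Set ↥X} (hU : IsOpen U) (hU' : ¬ IsClosed U) :
    ∃ x : ↥X, x ∉ U ∧ ∃ s : ℝ, s ≠ 0 ∧
      ∀ᶠ t in 𝓝[>] (0 : ℝ), (x : ℝ) + s * t ∈ ((↑) : ↥X → ℝ) '' U := by
  obtain ⟨p, hpU, hp⟩ : ∃ p ∈ closure U, p ∉ U := by
    by_contra! h
    exact hU' (isClosed_of_closure_subset h)
  obtain ⟨δ, hδ, hball⟩ := Metric.isOpen_iff.1 hX p p.2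
  obtain ⟨u, huU, hu⟩ := Metric.mem_closure_iff.1 hpU δ hδ
  have hup : (u : ℝ) ∈ Metric.ball (p : ℝ) δ := by rwa [Metric.mem_ball, dist_comm]
  set s : ℝ := u - p with hs
  have hseg : ∀ t ∈ Icc (0 : ℝ) 1, (p : ℝ) + t * s ∈ X := fun t ht =>
    hball ((convex_ball (p : ℝ) δ).add_smul_sub_mem (Metric.mem_ball_self hδ) hup ht)
  have hs0 : s ≠ 0 := fun h => hp ((Subtype.ext (sub_eq_zero.1 h) : u = p) ▸ huU)
  have hVo : IsOpen (((↑) : ↥X → ℝ) '' U) := hX.isOpenMap_subtype_val U hU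
  let K : Set ℝ := Icc 0 1 ∩ (fun t => (p : ℝ) + t * s) ⁻¹' (((↑) : ↥X → ℝ) '' U)ᶜ
  have hK : IsCompact K :=
    isCompact_Icc.inter_right (hVo.isClosed_compl.preimage (by fun_prop))
  have h0 : (0 : ℝ) ∈ K := by
    refine ⟨⟨le_rfl, zero_le_one⟩, ?_⟩
    rintro ⟨y, hy, hyp⟩
    exact hp ((Subtype.ext (by simpa using hyp) : y = p) ▸ hy)
  obtain ⟨t₀, ht₀, hmax⟩ := hK.exists_isGreatest ⟨0, h0⟩
  have ht₀1 : t₀ < 1 := by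
    refine lt_of_le_of_ne ht₀.1.2 ?_
    rintro rfl
    exact ht₀.2 ⟨u, huU, by simp [hs]⟩
  refine ⟨⟨p + t₀ * s, hseg t₀ ht₀.1⟩, fun h => ht₀.2 ⟨_, h, rfl⟩, s, hs0,
    eventually_nhdsGT_zero_iff.2 ⟨1 - t₀, by linarith, fun t ht => ?_⟩⟩
  by_contra hcon
  have := hmax (show t₀ + t ∈ K from ⟨⟨by linarith [ht₀.1.1, ht.1], by linarith [ht.2]⟩, by
    simpa only [mem_preimage, mem_compl_iff,
      show (p : ℝ) + (t₀ + t) * s = p + t₀ * s + s * t by ring]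
      using hcon⟩)
  linarith [ht.1]

end LocalTranslations

section IntervalExchange

variable {X : Set ℝ} {T : ↥X → ↥X}

theorem IsFiniteUnionOfIntervals.isOpen (h : IsFiniteUnionOfIntervals X) : IsOpen X := by
  obtain ⟨n, a, b, -, rfl, -⟩ := h
  exact isOpen_iUnion fun _ => isOpen_Ioo

theorem IsFiniteUnionOfIntervals.isBounded (h : IsFiniteUnionOfIntervals X) :
    Bornology.IsBounded X := by
  obtain ⟨n, a, b, -, rfl, -⟩ := h
  exact Bornology.isBounded_iUnion.2 fun i => Metric.isBounded_Ioo _ _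

theorem IsFiniteUnionOfIntervals.finite_closure_sdiff (h : IsFiniteUnionOfIntervals X) :
    (closure X \ X).Finite := by
  obtain ⟨n, a, b, -, rfl, -⟩ := h
  refine ((finite_range a).union (finite_range b)).subset ?_
  rintro p ⟨hp, hpX⟩
  have hcl : closure (⋃ i, Ioo (a i) (b i)) ⊆ ⋃ i, Icc (a i) (b i) :=
    closure_minimal (iUnion_mono fun i => Ioo_subset_Icc_self)
      (isClosed_iUnion_of_finite fun i => isClosed_Icc)
  obtain ⟨i, hi⟩ := mem_iUnion.1 (hcl hp)
  rcases hi.1.eq_or_lt with h | h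
  · exact Or.inl ⟨i, h⟩
  rcases hi.2.eq_or_lt with h' | h'
  · exact Or.inr ⟨i, h'.symm⟩
  · exact (hpX (mem_iUnion.2 ⟨i, h, h'⟩)).elim

theorem nhdsNE_neBot_of_isOpen (hX : IsOpen X) (x : ↥X) : (𝓝[≠] x).NeBot := by
  refine neBot_iff.2 fun h => ?_
  have := hX.isOpenMap_subtype_val _ ((isOpen_singleton_iff_punctured_nhds x).2 h)
  rw [image_singleton] at this
  exact not_isOpen_singleton _ this

theorem IsTranslationOnComponents.isLocalTranslation (h : IsTranslationOnComponents X T)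
    {e : OpenPartialHomeomorph ↥X ↥X} (hT : (e : ↥X → ↥X) = T) (hs : e.source = (Sing T)ᶜ) :
    IsLocalTranslation e := by
  intro J hJ hJe x hx y hy
  rw [hs] at hJe
  rw [hT]
  exact h x y (hJe hx) (hJ.subset_connectedComponentIn hx hJe hy)

/-- If the iterated images of an open set cover `X`, then every one-sided germ of `X` at a point
of `closure X` is contained in a single iterated image. -/
theorem exists_iterImg_of_germ {e : OpenPartialHomeomorph ↥X ↥X} (he : IsLocalTranslation e)
    (hT : (e : ↥X → ↥X) = T) (hs : e.source = (Sing T)ᶜ) (hsrc : e.sourceᶜ.Finite)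
    (hX : IsOpen X) (hfr : (closure X \ X).Finite) (hper : ∀ x, ¬ IsPeriodicOrbit T x)
    {I : Set ↥X} (hI : IsOpen I) (hcov : ⋃ k : ℤ, iterImg T k I = univ) {s : ℝ} (hs0 : s ≠ 0)
    {p : ℝ} (hp : ∀ᶠ t in 𝓝[>] (0 : ℝ), p + s * t ∈ X) :
    ∃ k : ℤ, ∀ᶠ t in 𝓝[>] (0 : ℝ), p + s * t ∈ ((↑) : ↥X → ℝ) '' iterImg T k I := by
  have hlim : ∀ p : ℝ, Tendsto (fun t : ℝ => p + s * t) (𝓝[>] 0) (𝓝 p) := fun p =>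
    Tendsto.mono_left (Continuous.tendsto' (by fun_prop) _ _ (by simp)) nhdsWithin_le_nhds
  let Bad := {p : ℝ // (∀ᶠ t in 𝓝[>] (0 : ℝ), p + s * t ∈ X) ∧
    ∀ k : ℤ, ¬ ∀ᶠ t in 𝓝[>] (0 : ℝ), p + s * t ∈ ((↑) : ↥X → ℝ) '' iterImg T k I}
  by_contra hcon
  let p₀ : Bad := ⟨p, hp, not_exists.1 hcon⟩
  have hinj : InjOn T (Sing T)ᶜ := by rw [← hs, ← hT]; exact e.injOn
  have hbadX : ∀ p : Bad, (p : ℝ) ∈ closure X \ X := by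
    refine fun p => ⟨mem_closure_of_tendsto (hlim p) p.2.1, fun hpX => ?_⟩
    obtain ⟨k, hk⟩ := mem_iUnion.1 (hcov.symm ▸ mem_univ (⟨p, hpX⟩ : ↥X))
    exact p.2.2 k ((hlim p).eventually
      ((hX.isOpenMap_subtype_val _ (isOpen_iterImg hT hs hI k)).mem_nhds ⟨_, hk, rfl⟩))
  have hfin : Finite Bad := by
    have := hfr.to_subtype
    exact Finite.of_injective (fun p : Bad => (⟨p, hbadX p⟩ : ↥(closure X \ X)))
      fun p q h => Subtype.ext (Subtype.mk.inj h)
  have hnext : ∀ p : Bad, ∃ q : Bad, ∀ᶠ t in 𝓝[>] (0 : ℝ),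
      ∃ x ∉ Sing T, (x : ℝ) = p + s * t ∧ (T x : ℝ) = q + s * t := by
    intro p
    have hps : ∀ᶠ t in 𝓝[>] (0 : ℝ), (p : ℝ) + s * t ∈ ((↑) : ↥X → ℝ) '' e.source := by
      filter_upwards [p.2.1, eventually_add_mul_notMem (hsrc.image ((↑) : ↥X → ℝ)) p hs0]
        with t htX htB
      exact ⟨⟨_, htX⟩, by_contra fun h => htB ⟨_, h, rfl⟩, rfl⟩
    obtain ⟨ε, hε, h⟩ := eventually_nhdsGT_zero_iff.1 hps
    obtain ⟨q, hq⟩ := he.exists_ray h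
    have hq' : ∀ᶠ t in 𝓝[>] (0 : ℝ),
        ∃ x ∉ Sing T, (x : ℝ) = p + s * t ∧ (T x : ℝ) = q + s * t := by
      refine eventually_nhdsGT_zero_iff.2 ⟨ε, hε, fun t ht => ?_⟩
      obtain ⟨x, hx, h⟩ := hq t ht
      exact ⟨x, by simpa [hs] using hx, h.1, hT ▸ h.2⟩
    refine ⟨⟨q, ?_, fun k hk => p.2.2 (k - 1) ?_⟩, hq'⟩
    · filter_upwards [hq'] with t ⟨x, _, _, hxq⟩
      exact hxq ▸ (T x).2
    · filter_upwards [hq', hk] with t ⟨x, hx, hxp, hxq⟩ ⟨y, hy, hyq⟩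
      obtain rfl : y = T x := Subtype.ext (hyq.trans hxq.symm)
      refine ⟨x, (mem_iterImg_succ_iff hinj hx I (k - 1)).1 ?_, hxp⟩
      rwa [sub_add_cancel]
  choose f hf using hnext
  have hiter : ∀ (j : ℕ) (p : Bad), ∀ᶠ t in 𝓝[>] (0 : ℝ), ∃ x y : ↥X, (x : ℝ) = p + s * t ∧
      (y : ℝ) = f^[j] p + s * t ∧ y ∈ (img T)^[j] {x} := by
    intro j p
    induction j with
    | zero =>
      filter_upwards [p.2.1] with t ht
      exact ⟨⟨_, ht⟩, ⟨_, ht⟩, rfl, rfl, rfl⟩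
    | succ j ih =>
      filter_upwards [ih, hf (f^[j] p)] with t ⟨x, y, hx, hy, hyx⟩ ⟨z, hz, hzp, hzq⟩
      obtain rfl : z = y := Subtype.ext (hzp.trans hy.symm)
      refine ⟨x, T z, hx, by rw [Function.iterate_succ_apply', hzq], ?_⟩
      rw [Function.iterate_succ_apply']
      exact ⟨z, ⟨hyx, hz⟩, rfl⟩
  obtain ⟨n, m, hne, heq⟩ := Finite.exists_ne_map_eq_of_infinite
    fun n : ℕ => f^[n] p₀
  wlog hnm : n < m generalizing n m
  · exact this m n hne.symm heq.symm (by omega)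
  set q := f^[n] p₀ with hq
  have hqm : f^[m - n] q = q := by
    rw [hq, ← Function.iterate_add_apply, Nat.sub_add_cancel hnm.le]
    exact heq.symm
  obtain ⟨t, x, y, hx, hy, hyx⟩ := (hiter (m - n) q).exists
  rw [hqm] at hy
  obtain rfl : x = y := Subtype.ext (hx.trans hy.symm)
  exact hper x ⟨m - n, by omega, hyx⟩

/-- If every one-sided germ of `X` lies in one of the open sets `W k`, and these sets cover `X`,
then finitely many of them cover `X`. -/
theorem IsFiniteUnionOfIntervals.exists_finset_cover (hX : IsFiniteUnionOfIntervals X)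
    {ι : Type*} {W : ι → Set ↥X} (hW : ∀ k, IsOpen (W k)) (hcov : ⋃ k, W k = univ)
    (hgerm : ∀ p s : ℝ, s ≠ 0 → (∀ᶠ t in 𝓝[>] (0 : ℝ), p + s * t ∈ X) →
      ∃ k, ∀ᶠ t in 𝓝[>] (0 : ℝ), p + s * t ∈ ((↑) : ↥X → ℝ) '' W k) :
    ∃ F : Finset ι, ⋃ k ∈ F, W k = univ := by
  classical
  have hXo := hX.isOpen
  obtain ⟨n, a, b, hab, hXab, -⟩ := hX
  have hsub : ∀ i, Ioo (a i) (b i) ⊆ X := fun i =>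
    hXab ▸ subset_iUnion (fun i => Ioo (a i) (b i)) i
  have key : ∀ i, ∃ F : Finset ι, ∀ x : ↥X, (x : ℝ) ∈ Icc (a i) (b i) →
      (x : ℝ) ∈ Ioo (a i) (b i) → ∃ k ∈ F, x ∈ W k := by
    intro i
    refine (isCompact_Icc (a := a i) (b := b i)).induction_on
      (p := fun S => ∃ F : Finset ι, ∀ x : ↥X, (x : ℝ) ∈ S →
        (x : ℝ) ∈ Ioo (a i) (b i) → ∃ k ∈ F, x ∈ W k) ⟨∅, by simp⟩ ?_ ?_ ?_
    · rintro S S' hS ⟨F, hF⟩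
      exact ⟨F, fun x hx => hF x (hS hx)⟩
    · rintro S S' ⟨F, hF⟩ ⟨F', hF'⟩
      refine ⟨F ∪ F', fun x hx hxi => ?_⟩
      rcases hx with hx | hx
      · obtain ⟨k, hk, h⟩ := hF x hx hxi
        exact ⟨k, Finset.mem_union_left _ hk, h⟩
      · obtain ⟨k, hk, h⟩ := hF' x hx hxi
        exact ⟨k, Finset.mem_union_right _ hk, h⟩
    · intro p hp
      rcases hp.1.eq_or_lt with rfl | hpa
      · obtain ⟨k, hk⟩ := hgerm (a i) 1 one_ne_zero (eventually_nhdsGT_zero_iff.2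
          ⟨b i - a i, sub_pos.2 (hab i), fun t ht =>
            hsub i ⟨by linarith [ht.1], by linarith [ht.2]⟩⟩)
        obtain ⟨ε, hε, h⟩ := eventually_nhdsGT_zero_iff.1 hk
        refine ⟨Iio (a i + ε), mem_nhdsWithin_of_mem_nhds (Iio_mem_nhds (by linarith)), {k},
          fun x hx hxi => ⟨k, Finset.mem_singleton_self k, ?_⟩⟩
        obtain ⟨y, hy, hyx⟩ := h (x - a i) ⟨by linarith [hxi.1], by linarith [mem_Iio.1 hx]⟩
        exact (Subtype.ext (by linarith) : y = x) ▸ hy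
      rcases hp.2.eq_or_lt with rfl | hpb
      · obtain ⟨k, hk⟩ := hgerm (b i) (-1) (by norm_num) (eventually_nhdsGT_zero_iff.2
          ⟨b i - a i, sub_pos.2 (hab i), fun t ht =>
            hsub i ⟨by linarith [ht.2], by linarith [ht.1]⟩⟩)
        obtain ⟨ε, hε, h⟩ := eventually_nhdsGT_zero_iff.1 hk
        refine ⟨Ioi (b i - ε), mem_nhdsWithin_of_mem_nhds (Ioi_mem_nhds (by linarith)), {k},
          fun x hx hxi => ⟨k, Finset.mem_singleton_self k, ?_⟩⟩
        obtain ⟨y, hy, hyx⟩ := h (b i - x) ⟨by linarith [hxi.2], by linarith [mem_Ioi.1 hx]⟩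
        exact (Subtype.ext (by linarith) : y = x) ▸ hy
      · obtain ⟨k, hk⟩ := mem_iUnion.1
          (hcov.symm ▸ mem_univ (⟨p, hsub i ⟨hpa, hpb⟩⟩ : ↥X))
        refine ⟨((↑) : ↥X → ℝ) '' W k, mem_nhdsWithin_of_mem_nhds
          ((hXo.isOpenMap_subtype_val _ (hW k)).mem_nhds ⟨_, hk, rfl⟩), {k},
          fun x hx _ => ⟨k, Finset.mem_singleton_self k, ?_⟩⟩
        obtain ⟨y, hy, hyx⟩ := hx
        exact (Subtype.ext hyx : y = x) ▸ hy
  choose F hF using key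
  refine ⟨Finset.univ.biUnion F, eq_univ_of_forall fun x => ?_⟩
  obtain ⟨i, hi⟩ := mem_iUnion.1 (show (x : ℝ) ∈ ⋃ i, Ioo (a i) (b i) from hXab ▸ x.2)
  obtain ⟨k, hk, hxk⟩ := hF i x (Ioo_subset_Icc_self hi) hi
  exact mem_biUnion (Finset.mem_biUnion.2 ⟨i, Finset.mem_univ i, hk⟩) hxk

end IntervalExchange

/-- for an aperiodic, irreducible IET without connections the
orbit of every nonempty open interval covers `X`, in fact in finite time. -/
theorem iet_orbit_of_interval_covers (X : Set ℝ) (T : ↥X → ↥X) (hIET : IsIET X T)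
    (haperiodic : ∀ x : ↥X, ¬ IsPeriodicOrbit T x)
    (hirreducible : ¬ IETReducible X T)
    (hnoconn : ∀ x : ↥X, ¬ ((orbit T x).Finite ∧ ¬ IsPeriodicOrbit T x))
    (I : Set ↥X) (hne : I.Nonempty)
    (hint : ∃ a b : ℝ, (Subtype.val : ↥X → ℝ) '' I = Ioo a b) :
    (⋃ k : ℤ, iterImg T k I) = univ ∧
      ∃ K L : ℤ, K ≤ L ∧ (⋃ k ∈ Finset.Icc K L, iterImg T k I) = univ := by
  obtain ⟨hXint, ⟨⟨S, hS⟩, -⟩, hfin, htrans⟩ := hIET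
  have hXo := hXint.isOpen
  have : Nonempty ↥X := hne.to_type
  obtain ⟨e, hT, hs, htgt⟩ :=
    exists_openPartialHomeomorph_of_admissible (nhdsNE_neBot_of_isOpen hXo) hS
  have he := htrans.isLocalTranslation hT hs
  have hsrc : e.sourceᶜ.Finite := by rwa [hs, compl_compl]
  have htgtfin := he.finite_compl_target hXo hXint.finite_closure_sdiff hsrc htgt
  have hinj : InjOn T (Sing T)ᶜ := by rw [← hs, ← hT]; exact e.injOn
  have hI : IsOpen I := by
    obtain ⟨a, b, hab⟩ := hint
    rw [← preimage_image_eq I Subtype.val_injective, hab]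
    exact isOpen_Ioo.preimage continuous_subtype_val
  set U : Set ↥X := ⋃ k : ℤ, iterImg T k I with hUdef
  have hUo : IsOpen U := isOpen_iUnion fun k => isOpen_iterImg hT hs hI k
  have hUinv : ∀ x ∉ Sing T, T x ∈ U ↔ x ∈ U := by
    intro x hx
    simp only [hUdef, mem_iUnion]
    constructor
    · rintro ⟨k, hk⟩
      refine ⟨k - 1, (mem_iterImg_succ_iff hinj hx I (k - 1)).1 ?_⟩
      rwa [sub_add_cancel]
    · rintro ⟨k, hk⟩
      exact ⟨k + 1, (mem_iterImg_succ_iff hinj hx I k).2 hk⟩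
  have hUe : ∀ x ∈ e.source, e x ∈ U ↔ x ∈ U := by
    intro x hx
    rw [hT]
    exact hUinv x (by simpa [hs] using hx)
  have hUe' : ∀ x ∈ e.symm.source, e.symm x ∈ U ↔ x ∈ U := by
    intro x hx
    rw [← hUe _ (e.map_target hx), e.right_inv hx]
  have hUc : IsClosed U := by
    by_contra hUc
    obtain ⟨x, hx, s, hs0, hgap⟩ := exists_gap_endpoint hXo hUo hUc
    have horb : (orbit T x).Infinite := fun h => hnoconn x ⟨h, haperiodic x⟩
    rcases iterate_mem_source_or_symm hT hs haperiodic horb with ⟨h, h'⟩ | ⟨h, h'⟩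
    · exact he.false_of_gap hsrc hXint.isBounded hUe hx hs0 hgap h h'
    · exact he.symm.false_of_gap htgtfin hXint.isBounded hUe' hx hs0 hgap h h'
  have hcov : U = univ := by
    by_contra hU
    refine hirreducible ⟨U, hne.mono fun x hx => mem_iUnion.2 ⟨0, by simpa [iterImg] using hx⟩,
      hU, fun x hx => IsClopen.connectedComponent_subset ⟨hUc, hUo⟩ hx, ?_⟩
    rintro _ ⟨x, ⟨hx, hxS⟩, rfl⟩
    exact (hUinv x hxS).2 hx
  refine ⟨hcov, ?_⟩
  obtain ⟨F, hF⟩ := hXint.exists_finset_cover (isOpen_iterImg hT hs hI) hcov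
    fun p s hs0 hp => exists_iterImg_of_germ he hT hs hsrc hXo hXint.finite_closure_sdiff
      haperiodic hI hcov hs0 hp
  obtain ⟨K, hK⟩ := F.bddBelow
  obtain ⟨L, hL⟩ := F.bddAbove
  refine ⟨K, max K L, le_max_left K L, eq_univ_of_univ_subset (hF ▸ ?_)⟩
  exact biUnion_mono (fun k hk => Finset.mem_coe.2 (Finset.mem_Icc.2
    ⟨hK hk, (hL hk).trans (le_max_right K L)⟩)) fun _ _ => Subset.rfl
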